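/- arXiv:1205.1003 — 2 statements merged into one kernel-verified Lean document; each statement's English description precedes it below -/
import Mathlib

section
/- Let r ≥ 2. If M ∈ Mat(d,ℤ) is reversible mod 2^r, then det(M) ≡ 1 (mod 2^{r−1}) or det(M) ≡ −1 (mod 2^{r−1}). Moreover, if d = 2 and M ∈ Mat(2,ℤ) is reversible mod 2^r with det(M) ≡ −1 (mod 2^{r−1}), then M² ≡ 𝟙 (mod 2^{r−2}). -/
/-- An integer matrix `M` is *reversible mod `n`* if its reduction mod `n` is invertible and
is conjugate, within `GL(d, ℤ/nℤ)`, to its inverse. -/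
def ReversibleMod (d n : ℕ) (M : Matrix (Fin d) (Fin d) ℤ) : Prop :=
  IsUnit (M.map (Int.cast : ℤ → ZMod n)).det ∧
  ∃ A : Matrix (Fin d) (Fin d) (ZMod n), IsUnit A.det ∧
    A * M.map (Int.cast : ℤ → ZMod n) * A⁻¹ = (M.map (Int.cast : ℤ → ZMod n))⁻¹

/-- If `2 ^ (n + 2)` divides `a ^ 2 - 1`, then `a ≡ ±1` modulo `2 ^ (n + 1)`. -/
lemma two_pow_succ_dvd_sub_one_or_add_one {n : ℕ} {a : ℤ} (h : 2 ^ (n + 2) ∣ a ^ 2 - 1) :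
    2 ^ (n + 1) ∣ a - 1 ∨ 2 ^ (n + 1) ∣ a + 1 := by
  have h_odd : Odd a := by
    have h2 : (2 : ℤ) ∣ a ^ 2 - 1 := (dvd_pow_self 2 (by lia)).trans h
    by_contra ha
    obtain ⟨k, rfl⟩ := Int.not_odd_iff_even.mp ha
    ring_nf at h2
    lia
  obtain ⟨k, rfl⟩ := h_odd
  have hk : (2 : ℤ) ^ n ∣ k * (k + 1) := by
    rw [show (2 * k + 1) ^ 2 - 1 = 4 * (k * (k + 1)) by ring,
      show (2 : ℤ) ^ (n + 2) = 4 * 2 ^ n by ring] at h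
    exact (mul_dvd_mul_iff_left (by norm_num)).mp h
  rw [show 2 * k + 1 - 1 = 2 * k by ring, show 2 * k + 1 + 1 = 2 * (k + 1) by ring, pow_succ']
  rcases Int.even_or_odd' k with ⟨m, hm | hm⟩
  · have hc : IsCoprime (2 : ℤ) (k + 1) := ⟨-m, 1, by rw [hm]; ring⟩
    exact .inl (mul_dvd_mul_left 2 (hc.pow_left.dvd_of_dvd_mul_right hk))
  · have hc : IsCoprime (2 : ℤ) k := ⟨-m, 1, by rw [hm]; ring⟩
    exact .inr (mul_dvd_mul_left 2 (hc.pow_left.dvd_of_dvd_mul_left hk))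

lemma ReversibleMod.dvd_det_sq_sub_one {d n : ℕ} {M : Matrix (Fin d) (Fin d) ℤ}
    (h : ReversibleMod d n M) : (n : ℤ) ∣ M.det ^ 2 - 1 := by
  obtain ⟨hM, A, hA, h_conj⟩ := h
  have h_det := congrArg Matrix.det h_conj
  rw [Matrix.det_conj ((Matrix.isUnit_iff_isUnit_det A).mpr hA), Matrix.det_nonsing_inv] at h_det
  have h_mul := Ring.mul_inverse_cancel _ hM
  rw [← h_det, ← Int.cast_det] at h_mul
  rw [← ZMod.intCast_zmod_eq_zero_iff_dvd, Int.cast_sub, Int.cast_pow, Int.cast_one, sq, h_mul, sub_self]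

lemma ReversibleMod.dvd_trace_mul_det_sub_one {n : ℕ} {M : Matrix (Fin 2) (Fin 2) ℤ}
    (h : ReversibleMod 2 n M) : (n : ℤ) ∣ M.trace * (M.det - 1) := by
  obtain ⟨hM, A, hA, h_conj⟩ := h
  have h_trace := congrArg Matrix.trace h_conj
  rw [Matrix.trace_mul_cycle, Matrix.nonsing_inv_mul _ hA, one_mul, Matrix.inv_def,
    Matrix.trace_smul, smul_eq_mul] at h_trace
  have h_adj : (M.map (Int.cast : ℤ → ZMod n)).adjugate.trace =
      (M.map (Int.cast : ℤ → ZMod n)).trace := by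
    simp [Matrix.adjugate_fin_two, Matrix.trace_fin_two, add_comm]
  have h_cast : (M.map (Int.cast : ℤ → ZMod n)).trace = (M.trace : ZMod n) := by
    simp [Matrix.trace_fin_two]
  have h_mul := Ring.mul_inverse_cancel _ hM
  rw [h_adj, h_cast] at h_trace
  rw [← Int.cast_det] at h_trace h_mul
  rw [← ZMod.intCast_zmod_eq_zero_iff_dvd, Int.cast_mul, Int.cast_sub, Int.cast_one]
  linear_combination (M.det : ZMod n) * h_trace + (M.trace : ZMod n) * h_mul

lemma Matrix.sq_eq_trace_smul_sub_det {R : Type*} [CommRing R] (M : Matrix (Fin 2) (Fin 2) R) :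
    M ^ 2 = M.trace • M - M.det • 1 := by
  ext i j
  fin_cases i <;> fin_cases j <;>
    simp [sq, Matrix.mul_apply, Fin.sum_univ_two, Matrix.trace_fin_two, Matrix.det_fin_two] <;>
    ring

/-- Let `r ≥ 2`. If `M ∈ Mat(d,ℤ)` is reversible mod `2^r`, then
`det M ≡ ±1 (mod 2^{r−1})`. Moreover, if `d = 2` and `M` is reversible mod `2^r` with
`det M ≡ −1 (mod 2^{r−1})`, then `M² ≡ 𝟙 (mod 2^{r−2})`. -/
theorem reversible_mod_two_power
    (r : ℕ) (hr : 2 ≤ r) :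
    (∀ d : ℕ, ∀ M : Matrix (Fin d) (Fin d) ℤ, ReversibleMod d (2 ^ r) M →
      (M.det : ZMod (2 ^ (r - 1))) = 1 ∨ (M.det : ZMod (2 ^ (r - 1))) = -1) ∧
    (∀ M : Matrix (Fin 2) (Fin 2) ℤ, ReversibleMod 2 (2 ^ r) M →
      (M.det : ZMod (2 ^ (r - 1))) = -1 →
      (M ^ 2).map (Int.cast : ℤ → ZMod (2 ^ (r - 2))) = 1) := by
  obtain ⟨n, rfl⟩ := Nat.exists_eq_add_of_le' hr
  refine ⟨fun d M hM ↦ ?_, fun M hM h_det ↦ ?_⟩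
  · change (M.det : ZMod (2 ^ (n + 1))) = 1 ∨ (M.det : ZMod (2 ^ (n + 1))) = -1
    have h_sq := hM.dvd_det_sq_sub_one
    push_cast at h_sq
    refine (two_pow_succ_dvd_sub_one_or_add_one h_sq).imp (fun h ↦ ?_) (fun h ↦ ?_)
    · rw [← sub_eq_zero]
      exact_mod_cast (ZMod.intCast_zmod_eq_zero_iff_dvd (M.det - 1) (2 ^ (n + 1))).mpr (mod_cast h)
    · rw [← add_eq_zero_iff_eq_neg]
      exact_mod_cast (ZMod.intCast_zmod_eq_zero_iff_dvd (M.det + 1) (2 ^ (n + 1))).mpr (mod_cast h)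
  · change (M.det : ZMod (2 ^ (n + 1))) = -1 at h_det
    change (M ^ 2).map (Int.cast : ℤ → ZMod (2 ^ n)) = 1
    have h_add : (2 : ℤ) ^ (n + 1) ∣ M.det + 1 := by
      rw [← add_eq_zero_iff_eq_neg] at h_det
      exact_mod_cast
        (ZMod.intCast_zmod_eq_zero_iff_dvd (M.det + 1) (2 ^ (n + 1))).mp (mod_cast h_det)
    have h_trace : (2 : ℤ) ^ n ∣ M.trace := by
      rcases n with _ | n
      · simp
      obtain ⟨k, hk⟩ := h_add
      have h_mul := hM.dvd_trace_mul_det_sub_one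
      push_cast at h_mul
      rw [show M.trace * (M.det - 1) = 2 * (M.trace * (2 ^ (n + 1) * k - 1)) by
        linear_combination M.trace * hk, pow_succ' _ (n + 1 + 1)] at h_mul
      have hc : IsCoprime (2 : ℤ) (2 ^ (n + 1) * k - 1) := ⟨2 ^ n * k, -1, by ring⟩
      exact (pow_dvd_pow 2 (Nat.le_succ _)).trans
        (hc.pow_left.dvd_of_dvd_mul_right ((mul_dvd_mul_iff_left two_ne_zero).mp h_mul))
    have h_trace_zero : (M.trace : ZMod (2 ^ n)) = 0 :=
      (ZMod.intCast_zmod_eq_zero_iff_dvd _ _).mpr (mod_cast h_trace)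
    have h_det_eq : (M.det : ZMod (2 ^ n)) = -1 := by
      rw [← add_eq_zero_iff_eq_neg]
      exact_mod_cast (ZMod.intCast_zmod_eq_zero_iff_dvd (M.det + 1) (2 ^ n)).mpr
        (mod_cast (pow_dvd_pow 2 n.le_succ).trans h_add)
    ext i j
    rw [Matrix.sq_eq_trace_smul_sub_det]
    change ((M.trace * M i j - M.det * (1 : Matrix (Fin 2) (Fin 2) ℤ) i j : ℤ) : ZMod (2 ^ n)) = _
    rw [Int.cast_sub, Int.cast_mul, Int.cast_mul, h_trace_zero, h_det_eq]
    by_cases hij : i = j <;> simp [Matrix.one_apply, hij]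
end

section
/- Let M ∈ GL(2,ℤ) with det(M) = −1 be reversible mod n for infinitely many integers n ≥ 1. Then M² = 𝟙 (as an integer matrix). -/
/-- The inverse of a `2 × 2` matrix of determinant `-1` has the opposite trace. -/
theorem trace_inv_of_det_eq_neg_one {R : Type*} [CommRing R] {B : Matrix (Fin 2) (Fin 2) R}
    (hB : B.det = -1) : B⁻¹.trace = -B.trace := by
  have hinv : B⁻¹ = -B.adjugate :=
    Matrix.inv_eq_right_inv (by rw [mul_neg, Matrix.mul_adjugate, hB, neg_smul, neg_neg, one_smul])
  rw [hinv, Matrix.trace_neg, Matrix.adjugate_fin_two, Matrix.trace_fin_two, Matrix.trace_fin_two]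
  simp [add_comm]

/-- A matrix of determinant `-1` that is reversible mod `n` has twice its trace divisible by `n`. -/
theorem ReversibleMod.dvd_two_mul_trace {n : ℕ} {M : Matrix (Fin 2) (Fin 2) ℤ}
    (h : ReversibleMod 2 n M) (hdet : M.det = -1) : (n : ℤ) ∣ 2 * M.trace := by
  obtain ⟨-, A, hA, hconj⟩ := h
  have hdet' : (M.map (Int.cast : ℤ → ZMod n)).det = -1 := by
    rw [← Int.cast_det, hdet, Int.cast_neg, Int.cast_one]
  have htr := congrArg Matrix.trace hconj
  rw [trace_inv_of_det_eq_neg_one hdet', Matrix.trace_mul_cycle, Matrix.nonsing_inv_mul A hA,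
    one_mul] at htr
  have hcast : (M.map (Int.cast : ℤ → ZMod n)).trace = (M.trace : ZMod n) := by
    simp [Matrix.trace_fin_two]
  rw [hcast] at htr
  rw [← CharP.intCast_eq_zero_iff (ZMod n)]
  push_cast
  linear_combination htr

/-- If `M ∈ GL(2,ℤ)` with `det M = −1` is reversible mod `n` for
infinitely many `n ≥ 1`, then `M² = 𝟙` as an integer matrix. -/
theorem sq_eq_one_of_det_neg_one_reversible_for_infinitely_many
    (M : Matrix (Fin 2) (Fin 2) ℤ) (hdet : M.det = -1)
    (hinf : {n : ℕ | 1 ≤ n ∧ ReversibleMod 2 n M}.Infinite) :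
    M ^ 2 = 1 := by
  obtain ⟨n, ⟨-, hn⟩, hlt⟩ := hinf.exists_gt (2 * M.trace).natAbs
  have htr : M.trace = 0 := by
    have := Int.eq_zero_of_dvd_of_natAbs_lt_natAbs (hn.dvd_two_mul_trace hdet) (by simpa using hlt)
    omega
  rw [Matrix.det_fin_two] at hdet
  rw [Matrix.trace_fin_two] at htr
  rw [pow_two]
  ext i j
  fin_cases i <;> fin_cases j <;> simp [Matrix.mul_apply, Fin.sum_univ_two]
  · linear_combination M 0 0 * htr - hdet
  · linear_combination M 0 1 * htr
  · linear_combination M 1 0 * htr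
  · linear_combination M 1 1 * htr - hdet
end
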